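/- For a compact subset A of a Banach space V, the set of all barycenters of Borel probability measures supported on A equals the closed convex hull of A, and hence equals the Choquet hull of A. -/

import Mathlib

open MeasureTheory

open MeasureTheory

/-- `μ` has barycenter `y`. -/
def IsBarycenter {V : Type*} [NormedAddCommGroup V] [NormedSpace ℝ V] [MeasurableSpace V]
    (μ : Measure V) (y : V) : Prop :=
  ∀ L : V →L[ℝ] ℝ, L y = ∫ x, L x ∂μ

/-- `μ` is supported on `A`. -/
def SupportedOn {V : Type*} [MeasurableSpace V] (μ : Measure V) (A : Set V) : Prop :=
  ∃ B : Set V, MeasurableSet B ∧ B ⊆ A ∧ μ B = 1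

/-- `A` is a Choquet set. -/
def IsChoquetSet {V : Type*} [NormedAddCommGroup V] [NormedSpace ℝ V] [MeasurableSpace V]
    [BorelSpace V] (A : Set V) : Prop :=
  ∀ μ : Measure V, IsProbabilityMeasure μ → μ.Regular → SupportedOn μ A →
    ∀ y : V, IsBarycenter μ y → y ∈ A

/-- The Choquet hull of `A` is the smallest Choquet set containing `A`. -/
def choquetHull {V : Type*} [NormedAddCommGroup V] [NormedSpace ℝ V] [MeasurableSpace V]
    [BorelSpace V] (A : Set V) : Set V :=
  ⋂₀ {C : Set V | A ⊆ C ∧ IsChoquetSet C}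

theorem SupportedOn.mono {V : Type*} [MeasurableSpace V] {μ : Measure V} {A C : Set V}
    (hμ : SupportedOn μ A) (hAC : A ⊆ C) : SupportedOn μ C :=
  let ⟨B, hB, hBA, h⟩ := hμ
  ⟨B, hB, hBA.trans hAC, h⟩

/-- A compact convex set contains the barycenters of the probability measures it supports. -/
theorem IsBarycenter.mem_of_isCompact_of_convex {V : Type*} [NormedAddCommGroup V]
    [NormedSpace ℝ V] [MeasurableSpace V] [BorelSpace V] {μ : Measure V} [IsProbabilityMeasure μ]
    {K : Set V} (hK : IsCompact K) (hc : Convex ℝ K) (hμ : SupportedOn μ K) {y : V}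
    (hy : IsBarycenter μ y) : y ∈ K := by
  obtain ⟨B, hB, hBK, hμB⟩ := hμ
  have hae : ∀ᵐ x ∂μ, x ∈ K :=
    Filter.mem_of_superset (mem_ae_iff.2 ((prob_compl_eq_zero_iff hB).2 hμB)) hBK
  by_contra hyK
  obtain ⟨L, u, hLy, hLK⟩ := geometric_hahn_banach_point_closed hc hK.isClosed hyK
  obtain ⟨M, hM⟩ := hK.exists_bound_of_continuousOn L.continuous.continuousOn
  have hint : Integrable (fun x => L x) μ :=
    .of_bound L.continuous.measurable.aestronglyMeasurable M (hae.mono fun x hx => hM x hx)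
  have hle : ∫ _, u ∂μ ≤ ∫ x, L x ∂μ :=
    integral_mono_ae (integrable_const u) hint (hae.mono fun x hx => (hLK x hx).le)
  rw [← hy L] at hle
  simp only [integral_const, probReal_univ, one_smul] at hle
  linarith

/-- A finite Borel measure concentrated on a compact set of a pseudometrizable space is regular. -/
theorem MeasureTheory.Measure.regular_of_measure_compl_isCompact_eq_zero {X : Type*}
    [TopologicalSpace X] [TopologicalSpace.PseudoMetrizableSpace X] [MeasurableSpace X]
    [BorelSpace X] {μ : Measure X} [IsFiniteMeasure μ] {A : Set X} (hA : IsCompact A) (hμ : μ Aᶜ = 0) :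
    μ.Regular where
  innerRegular U hU r hr := by
    obtain ⟨F, hFU, hF, hrF⟩ := Measure.WeaklyRegular.innerRegular (μ := μ) hU r hr
    refine ⟨F ∩ A, Set.inter_subset_left.trans hFU, hA.inter_left hF, ?_⟩
    rwa [measure_inter_conull hμ]

/-- Every point of the closed convex hull of a compact set `A` is represented by a probability
measure on `A`. -/
theorem exists_probabilityMeasure_of_mem_closure_convexHull {V : Type*} [NormedAddCommGroup V]
    [NormedSpace ℝ V] [MeasurableSpace V] [BorelSpace V] {A : Set V} (hA : IsCompact A) {y : V}
    (hy : y ∈ closure (convexHull ℝ A)) :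
    ∃ P : ProbabilityMeasure A, ∀ L : V →L[ℝ] ℝ, L y = ∫ x : A, L x ∂(P : Measure A) := by
  have : CompactSpace A := isCompact_iff_compactSpace.1 hA
  let R : Set (ProbabilityMeasure A × V) :=
    {p | ∀ L : V →L[ℝ] ℝ, L p.2 = ∫ x : A, L x ∂(p.1 : Measure A)}
  have hint (μ : Measure A) [IsFiniteMeasure μ] (L : V →L[ℝ] ℝ) :
      Integrable (fun x : A => L x) μ :=
    (BoundedContinuousFunction.mkOfCompact ⟨fun x : A => L x, by fun_prop⟩).integrable μ
  have hR : IsClosed R := by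
    simp only [R, Set.ofPred_forall]
    refine isClosed_iInter fun L => isClosed_eq (by fun_prop) ?_
    exact (ProbabilityMeasure.continuous_integral_boundedContinuousFunction
      (BoundedContinuousFunction.mkOfCompact ⟨fun x : A => L x, by fun_prop⟩)).comp continuous_fst
  have hclosed : IsClosed (Prod.snd '' R) := isClosedMap_snd_of_compactSpace R hR
  have hAR : A ⊆ Prod.snd '' R := fun a ha =>
    ⟨(⟨Measure.dirac ⟨a, ha⟩, inferInstance⟩, a), fun L => by simp, rfl⟩
  have hconv : Convex ℝ (Prod.snd '' R) := by
    rintro _ ⟨⟨P, x⟩, hP, rfl⟩ _ ⟨⟨Q, z⟩, hQ, rfl⟩ a b ha hb hab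
    let ν : Measure A := ENNReal.ofReal a • (P : Measure A) + ENNReal.ofReal b • (Q : Measure A)
    have hν : IsProbabilityMeasure ν := ⟨by
      simp [ν, ← ENNReal.ofReal_add ha hb, hab]⟩
    refine ⟨(⟨ν, hν⟩, a • x + b • z), fun L => ?_, rfl⟩
    have hPL : L x = _ := hP L
    have hQL : L z = _ := hQ L
    change L (a • x + b • z) = ∫ x : A, L x ∂ν
    rw [integral_add_measure ((hint _ L).smul_measure ENNReal.ofReal_ne_top)
      ((hint _ L).smul_measure ENNReal.ofReal_ne_top), integral_smul_measure,
      integral_smul_measure, ENNReal.toReal_ofReal ha, ENNReal.toReal_ofReal hb, map_add, map_smul,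
      map_smul, hPL, hQL]
  obtain ⟨⟨P, _⟩, hP, rfl⟩ := closure_minimal (convexHull_min hAR hconv) hclosed hy
  exact ⟨P, hP⟩

/-- For a compact subset `A` of a Banach space, the set of barycenters of Borel
probability measures supported on `A` equals the closed convex hull of `A`, which
in turn equals the Choquet hull of `A`. -/
theorem barycenters_of_compact_eq_closedConvexHull
    {V : Type*} [NormedAddCommGroup V] [NormedSpace ℝ V] [CompleteSpace V]
    [MeasurableSpace V] [BorelSpace V] (A : Set V) (hA : IsCompact A) :
    {y : V | ∃ μ : Measure V, IsProbabilityMeasure μ ∧ μ.Regular ∧ SupportedOn μ A ∧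
        IsBarycenter μ y} = closure (convexHull ℝ A) ∧
    choquetHull A = closure (convexHull ℝ A) := by
  have hsub : A ⊆ closure (convexHull ℝ A) := (subset_convexHull ℝ A).trans subset_closure
  have hK : IsCompact (closure (convexHull ℝ A)) :=
    hA.totallyBounded.convexHull.closure.isCompact_of_isClosed isClosed_closure
  have hc : Convex ℝ (closure (convexHull ℝ A)) := (convex_convexHull ℝ A).closure
  have hbary : {y : V | ∃ μ : Measure V, IsProbabilityMeasure μ ∧ μ.Regular ∧ SupportedOn μ A ∧
      IsBarycenter μ y} = closure (convexHull ℝ A) := by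
    refine Set.Subset.antisymm ?_ fun y hy => ?_
    · rintro y ⟨μ, _, -, hμ, hy⟩
      exact hy.mem_of_isCompact_of_convex hK hc (hμ.mono hsub)
    · obtain ⟨P, hP⟩ := exists_probabilityMeasure_of_mem_closure_convexHull hA hy
      have hmA : MeasurableSet A := hA.measurableSet
      have hprob : IsProbabilityMeasure ((P : Measure A).map Subtype.val) :=
        Measure.isProbabilityMeasure_map measurable_subtype_coe.aemeasurable
      have hone : (P : Measure A).map Subtype.val A = 1 := by
        rw [Measure.map_apply measurable_subtype_coe hmA, Subtype.coe_preimage_self, measure_univ]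
      refine ⟨_, hprob, ?_, ⟨A, hmA, subset_rfl, hone⟩, fun L => ?_⟩
      · exact Measure.regular_of_measure_compl_isCompact_eq_zero hA
          ((prob_compl_eq_zero_iff hmA).2 hone)
      · rw [hP L, integral_map measurable_subtype_coe.aemeasurable
          L.continuous.measurable.aestronglyMeasurable]
  refine ⟨hbary, Set.Subset.antisymm (Set.sInter_subset_of_mem ⟨hsub, ?_⟩) ?_⟩
  · intro μ _ _ hμ y hy
    exact hy.mem_of_isCompact_of_convex hK hc hμ
  · rw [← hbary]
    rintro y ⟨μ, hprob, hreg, hμ, hy⟩ C ⟨hAC, hC⟩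
    exact hC μ hprob hreg (hμ.mono hAC) y hy
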